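/- Let A₀ ∈ Mₙ(ℝ) satisfy f(A₀) > 0. Then there exists a differentiable curve A : [0,∞) → Mₙ(ℝ) with A(0) = A₀ solving the reduced Anomaly flow ODE A′(t) = f(A(t))·(2[[A(t)⁺,A(t)⁻],A(t)] − ‖A(t)⁺‖²·A(t)) for all t ≥ 0; moreover ‖A(t)‖ ≤ ‖A₀‖ for all t ≥ 0. (The Anomaly flow with initial balanced metric satisfying f(ω₀) > 0 is immortal.) -/

import Mathlib

noncomputable section

open Matrix

attribute [local instance] Matrix.normedAddCommGroup Matrix.normedSpace

/-- The symmetric part `X⁺ = (X + Xᵀ)/2` of a square matrix. -/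
def symPart {n : ℕ} (X : Matrix (Fin n) (Fin n) ℝ) : Matrix (Fin n) (Fin n) ℝ :=
  (1/2 : ℝ) • (X + Xᵀ)

/-- The skew-symmetric part `X⁻ = (X − Xᵀ)/2` of a square matrix. -/
def skewPart {n : ℕ} (X : Matrix (Fin n) (Fin n) ℝ) : Matrix (Fin n) (Fin n) ℝ :=
  (1/2 : ℝ) • (X - Xᵀ)

/-- The matrix commutator `[X, Y] = XY − YX`. -/
def mcomm {n : ℕ} (X Y : Matrix (Fin n) (Fin n) ℝ) : Matrix (Fin n) (Fin n) ℝ :=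
  X * Y - Y * X

/-- The squared Frobenius norm `‖X‖² = ⟨X, X⟩ = tr(XXᵀ)`. -/
def nsq {n : ℕ} (X : Matrix (Fin n) (Fin n) ℝ) : ℝ := Matrix.trace (X * Xᵀ)

/-- `f(X) = 1 − c‖X⁺‖²`, where `c` corresponds to `(α'/4)·(τ(τ−1)²/8)`. -/
def fval (c : ℝ) {n : ℕ} (X : Matrix (Fin n) (Fin n) ℝ) : ℝ := 1 - c * nsq (symPart X)

/-- The right-hand side of the reduced Anomaly flow ODE:
`f(X)·(2[[X⁺,X⁻],X] − ‖X⁺‖²·X)`. -/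
def rhs (c : ℝ) {n : ℕ} (X : Matrix (Fin n) (Fin n) ℝ) : Matrix (Fin n) (Fin n) ℝ :=
  fval c X • ((2 : ℝ) • mcomm (mcomm (symPart X) (skewPart X)) X - nsq (symPart X) • X)

open Set Metric Filter Topology in
/-- A locally Lipschitz, compactly supported vector field has global forward solutions. -/
theorem global_sol {E : Type*} [NormedAddCommGroup E] [NormedSpace ℝ E] [ProperSpace E]
    [CompleteSpace E] (G : E → E) (hG : LocallyLipschitz G) (hc : HasCompactSupport G) (x₀ : E) :
    ∃ α : ℝ → E, α 0 = x₀ ∧ ∀ t ∈ Ici (0:ℝ), HasDerivWithinAt α (G (α t)) (Ici 0) t := by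
  obtain ⟨C, hC⟩ := hG.continuous.bounded_above_of_compact_support hc
  have hC0 : 0 ≤ C := (norm_nonneg _).trans (hC x₀)
  have key : ∀ T : ℝ, ∃ β : ℝ → E, 0 ≤ T → β 0 = x₀ ∧
      ∀ t ∈ Icc 0 T, HasDerivWithinAt β (G (β t)) (Icc 0 T) t := by
    intro T
    by_cases hT : 0 ≤ T
    swap
    · exact ⟨fun _ => x₀, fun h => absurd h hT⟩
    obtain ⟨K, hK⟩ := (hG.locallyLipschitzOn (s := closedBall x₀ (C * T))).exists_lipschitzOnWith_of_compact
      (isCompact_closedBall _ _)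
    have hp : IsPicardLindelof (fun _ => G) (tmin := 0) (tmax := T) ⟨0, le_refl 0, hT⟩ x₀
        ⟨C * T, mul_nonneg hC0 hT⟩ 0 ⟨C, hC0⟩ K := by
      apply IsPicardLindelof.of_time_independent
      · intro x _; exact hC x
      · exact hK
      · simp [hT]; rfl
    obtain ⟨β, h1, h2⟩ := hp.exists_eq_forall_mem_Icc_hasDerivWithinAt₀
    exact ⟨β, fun _ => ⟨h1, h2⟩⟩
  choose β hβ using key
  have uniq : ∀ S T s : ℝ, 0 ≤ s → s < S → s < T → β S s = β T s := by
    intro S T s hs hS hT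
    obtain ⟨a1, a2⟩ := hβ S (hs.trans hS.le)
    obtain ⟨b1, b2⟩ := hβ T (hs.trans hT.le)
    have c1 : ContinuousOn (β S) (Icc 0 s) := fun t ht =>
      ((a2 t ⟨ht.1, ht.2.trans hS.le⟩).continuousWithinAt).mono (Icc_subset_Icc le_rfl hS.le)
    have c2 : ContinuousOn (β T) (Icc 0 s) := fun t ht =>
      ((b2 t ⟨ht.1, ht.2.trans hT.le⟩).continuousWithinAt).mono (Icc_subset_Icc le_rfl hT.le)
    obtain ⟨K, hK⟩ := (hG.locallyLipschitzOn
      (s := β S '' Icc 0 s ∪ β T '' Icc 0 s)).exists_lipschitzOnWith_of_compact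
      ((isCompact_Icc.image_of_continuousOn c1).union (isCompact_Icc.image_of_continuousOn c2))
    have dd : ∀ U, s < U → ∀ t ∈ Ico 0 s, ∀ (g : ℝ → E) g', HasDerivWithinAt g g' (Icc 0 U) t →
        HasDerivWithinAt g g' (Ici t) t := by
      intro U hU t ht g g' h
      refine (h.mono (Icc_subset_Icc ht.1 le_rfl)).mono_of_mem_nhdsWithin ?_
      exact Icc_mem_nhdsGE (ht.2.trans hU)
    refine ODE_solution_unique_of_mem_Icc_right (v := fun _ => G)
      (s := fun _ => β S '' Icc 0 s ∪ β T '' Icc 0 s) (fun _ _ => hK) c1 ?_ ?_ c2 ?_ ?_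
      (a1.trans b1.symm) ⟨hs, le_rfl⟩
    · intro t ht; exact dd S hS t ht _ _ (a2 t ⟨ht.1, ht.2.le.trans hS.le⟩)
    · intro t ht; exact Or.inl ⟨t, ⟨ht.1, ht.2.le⟩, rfl⟩
    · intro t ht; exact dd T hT t ht _ _ (b2 t ⟨ht.1, ht.2.le.trans hT.le⟩)
    · intro t ht; exact Or.inr ⟨t, ⟨ht.1, ht.2.le⟩, rfl⟩
  refine ⟨fun t => β (t+1) t, (hβ (0+1) (by norm_num)).1, ?_⟩
  intro t ht
  have ht0 : (0:ℝ) ≤ t := ht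
  have hd := (hβ (t+2) (by linarith)).2 t ⟨ht0, by linarith⟩
  have hm : Ico 0 (t+2) ∈ 𝓝[Ici 0] t := by
    rw [← Ici_inter_Iio]
    exact inter_mem self_mem_nhdsWithin (mem_nhdsWithin_of_mem_nhds (Iio_mem_nhds (by linarith)))
  have hd2 : HasDerivWithinAt (β (t+2)) (G (β (t+2) t)) (Ici 0) t :=
    hd.mono_of_mem_nhdsWithin (mem_of_superset hm Ico_subset_Icc_self)
  have he : (fun t => β (t+1) t) =ᶠ[𝓝[Ici 0] t] β (t+2) := by
    filter_upwards [hm] with s hs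
    exact uniq _ _ s hs.1 (by linarith) hs.2
  have he' : β (t+1) t = β (t+2) t := uniq _ _ t ht0 (by linarith) (by linarith)
  have := hd2.congr_of_eventuallyEq he he'
  simpa [he'] using this

theorem nsq_eq {n : ℕ} (X : Matrix (Fin n) (Fin n) ℝ) : nsq X = ∑ i, ∑ j, X i j ^ 2 := by
  simp [nsq, Matrix.trace, Matrix.mul_apply, sq]

theorem nsq_nonneg {n : ℕ} (X : Matrix (Fin n) (Fin n) ℝ) : 0 ≤ nsq X := by
  rw [nsq_eq]; positivity

theorem norm_sq_le_nsq {n : ℕ} (X : Matrix (Fin n) (Fin n) ℝ) : ‖X‖ ≤ Real.sqrt (nsq X) := by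
  rw [Matrix.norm_le_iff (Real.sqrt_nonneg _)]
  intro i j
  apply Real.le_sqrt_of_sq_le
  rw [nsq_eq, Real.norm_eq_abs, sq_abs]
  calc X i j ^ 2 ≤ ∑ j, X i j ^ 2 :=
        Finset.single_le_sum (f := fun j => X i j ^ 2) (fun _ _ => sq_nonneg _) (Finset.mem_univ j)
    _ ≤ _ := Finset.single_le_sum (f := fun i => ∑ j, X i j ^ 2)
        (fun _ _ => by positivity) (Finset.mem_univ i)

theorem contDiff_of_entries {n : ℕ} {F : Type*} [NormedAddCommGroup F] [NormedSpace ℝ F]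
    {g : F → Matrix (Fin n) (Fin n) ℝ} (h : ∀ i j, ContDiff ℝ 1 (fun x => g x i j)) :
    ContDiff ℝ 1 g :=
  contDiff_pi' fun i => contDiff_pi' fun j => h i j

theorem contDiff_entry {n : ℕ} {F : Type*} [NormedAddCommGroup F] [NormedSpace ℝ F]
    {g : F → Matrix (Fin n) (Fin n) ℝ} (h : ContDiff ℝ 1 g) (i j : Fin n) :
    ContDiff ℝ 1 (fun x => g x i j) :=
  contDiff_pi.1 (contDiff_pi.1 h i) j

theorem contDiff_nsq {n : ℕ} {F : Type*} [NormedAddCommGroup F] [NormedSpace ℝ F]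
    {g : F → Matrix (Fin n) (Fin n) ℝ} (h : ContDiff ℝ 1 g) : ContDiff ℝ 1 (fun x => nsq (g x)) := by
  simp only [nsq_eq]
  exact ContDiff.sum fun i _ => ContDiff.sum fun j _ => (contDiff_entry h i j).pow 2

theorem contDiff_mmul {n : ℕ} {F : Type*} [NormedAddCommGroup F] [NormedSpace ℝ F]
    {g k : F → Matrix (Fin n) (Fin n) ℝ} (h : ContDiff ℝ 1 g) (h' : ContDiff ℝ 1 k) :
    ContDiff ℝ 1 (fun x => g x * k x) := by
  apply contDiff_of_entries
  intro i j
  simp only [Matrix.mul_apply]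
  exact ContDiff.sum fun l _ => (contDiff_entry h i l).mul (contDiff_entry h' l j)

theorem contDiff_mtr {n : ℕ} {F : Type*} [NormedAddCommGroup F] [NormedSpace ℝ F]
    {g : F → Matrix (Fin n) (Fin n) ℝ} (h : ContDiff ℝ 1 g) :
    ContDiff ℝ 1 (fun x => (g x)ᵀ) :=
  contDiff_of_entries fun i j => contDiff_entry h j i

theorem contDiff_mcomm {n : ℕ} {F : Type*} [NormedAddCommGroup F] [NormedSpace ℝ F]
    {g k : F → Matrix (Fin n) (Fin n) ℝ} (h : ContDiff ℝ 1 g) (h' : ContDiff ℝ 1 k) :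
    ContDiff ℝ 1 (fun x => mcomm (g x) (k x)) :=
  (contDiff_mmul h h').sub (contDiff_mmul h' h)

theorem contDiff_symPart {n : ℕ} :
    ContDiff ℝ 1 (fun X : Matrix (Fin n) (Fin n) ℝ => symPart X) :=
  (contDiff_id.add (contDiff_mtr contDiff_id)).const_smul (1/2 : ℝ)

theorem contDiff_skewPart {n : ℕ} :
    ContDiff ℝ 1 (fun X : Matrix (Fin n) (Fin n) ℝ => skewPart X) :=
  (contDiff_id.sub (contDiff_mtr contDiff_id)).const_smul (1/2 : ℝ)

theorem contDiff_fval (c : ℝ) {n : ℕ} :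
    ContDiff ℝ 1 (fun X : Matrix (Fin n) (Fin n) ℝ => fval c X) :=
  contDiff_const.sub (contDiff_const.mul (contDiff_nsq contDiff_symPart))

/-- The field without the factor `f`. -/
def vfield {n : ℕ} (X : Matrix (Fin n) (Fin n) ℝ) : Matrix (Fin n) (Fin n) ℝ :=
  (2 : ℝ) • mcomm (mcomm (symPart X) (skewPart X)) X - nsq (symPart X) • X

theorem contDiff_vfield {n : ℕ} :
    ContDiff ℝ 1 (fun X : Matrix (Fin n) (Fin n) ℝ => vfield X) :=
  ((contDiff_mcomm (contDiff_mcomm contDiff_symPart contDiff_skewPart) contDiff_id).const_smul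
    (2 : ℝ)).sub ((contDiff_nsq contDiff_symPart).smul contDiff_id)

theorem mcomm_parts {n : ℕ} (X : Matrix (Fin n) (Fin n) ℝ) :
    mcomm (symPart X) (skewPart X) = (1/2 : ℝ) • (Xᵀ * X - X * Xᵀ) := by
  simp only [mcomm, symPart, skewPart, smul_mul_assoc, mul_smul_comm, smul_smul, ← smul_sub]
  have : (X + Xᵀ) * (X - Xᵀ) - (X - Xᵀ) * (X + Xᵀ) = (2:ℝ) • (Xᵀ * X - X * Xᵀ) := by
    rw [two_smul]; noncomm_ring
  rw [this, smul_smul]; norm_num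

theorem trace_vfield {n : ℕ} (X : Matrix (Fin n) (Fin n) ℝ) :
    Matrix.trace (vfield X * Xᵀ) ≤ 0 := by
  set M := mcomm (symPart X) (skewPart X) with hM
  have hMX : X * Xᵀ - Xᵀ * X = (-2 : ℝ) • M := by
    rw [hM, mcomm_parts, smul_smul]; norm_num
  have hMt : Mᵀ = M := by
    rw [hM, mcomm_parts]; simp
  have h1 : Matrix.trace (mcomm M X * Xᵀ) = -2 * nsq M := by
    have : Matrix.trace (mcomm M X * Xᵀ) = Matrix.trace (M * (X * Xᵀ - Xᵀ * X)) := by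
      rw [mcomm, sub_mul, mul_sub, Matrix.trace_sub, Matrix.trace_sub, ← mul_assoc,
        Matrix.mul_assoc X M Xᵀ, Matrix.trace_mul_comm X, Matrix.mul_assoc]
      simp [Matrix.mul_assoc]
    rw [this, hMX, nsq, hMt]; simp
  have h2 : Matrix.trace (vfield X * Xᵀ) = 2 * (-2 * nsq M) - nsq (symPart X) * nsq X := by
    rw [vfield, sub_mul, Matrix.trace_sub, smul_mul_assoc, smul_mul_assoc, Matrix.trace_smul,
      Matrix.trace_smul, ← hM, h1]; simp [nsq]
  rw [h2]
  nlinarith [nsq_nonneg M, mul_nonneg (nsq_nonneg (symPart X)) (nsq_nonneg X)]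

theorem hasDeriv_nsq {n : ℕ} {A : ℝ → Matrix (Fin n) (Fin n) ℝ} {A' : Matrix (Fin n) (Fin n) ℝ}
    {s : Set ℝ} {t : ℝ} (h : HasDerivWithinAt A A' s t) :
    HasDerivWithinAt (fun t => nsq (A t)) (2 * Matrix.trace (A' * (A t)ᵀ)) s t := by
  have he : ∀ i j, HasDerivWithinAt (fun t => A t i j) (A' i j) s t := fun i j =>
    hasDerivWithinAt_pi.1 (hasDerivWithinAt_pi.1 h i) j
  simp only [nsq_eq]
  have := HasDerivWithinAt.fun_sum (u := Finset.univ) (fun i (_ : i ∈ Finset.univ) =>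
    HasDerivWithinAt.fun_sum (u := Finset.univ) (fun j (_ : j ∈ Finset.univ) => (he i j).fun_pow 2))
  refine this.congr_deriv ?_
  simp only [Matrix.trace, Matrix.mul_apply, Matrix.diag, Matrix.transpose_apply, Finset.mul_sum]
  refine Finset.sum_congr rfl fun i _ => Finset.sum_congr rfl fun j _ => ?_
  simp; ring

/-- Cut-off field. -/
def gfield (c R : ℝ) {n : ℕ} (X : Matrix (Fin n) (Fin n) ℝ) : Matrix (Fin n) (Fin n) ℝ :=
  (min (max (R + 1 - nsq X) 0) 1 * max (fval c X) 0) • vfield X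

theorem loclip_smul {E F : Type*} [PseudoEMetricSpace E] [NormedAddCommGroup F] [NormedSpace ℝ F]
    {a b : E → ℝ} {v : E → F} (h1 : LocallyLipschitz a) (h2 : LocallyLipschitz b)
    (h3 : LocallyLipschitz v) : LocallyLipschitz (fun x => (a x * b x) • v x) := by
  have h4 : ContDiff ℝ 1 (fun p : (ℝ × ℝ) × F => (p.1.1 * p.1.2) • p.2) := by
    fun_prop
  have h5 := h4.locallyLipschitz (𝕂 := ℝ)
  have h6 := (h1.prodMk h2).prodMk h3
  exact h5.comp h6

theorem loclip_cut (R : ℝ) {n : ℕ} :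
    LocallyLipschitz (fun X : Matrix (Fin n) (Fin n) ℝ => min (max (R + 1 - nsq X) 0) 1) := by
  have h00 : ContDiff ℝ 1 (fun X : Matrix (Fin n) (Fin n) ℝ => R + 1 - nsq X) :=
    contDiff_const.sub (contDiff_nsq contDiff_id)
  have h0 := h00.locallyLipschitz (𝕂 := ℝ)
  exact LocallyLipschitz.min_const (LocallyLipschitz.max_const h0 0) 1

theorem loclip_fval (c : ℝ) {n : ℕ} :
    LocallyLipschitz (fun X : Matrix (Fin n) (Fin n) ℝ => max (fval c X) 0) := by
  have h0 := (contDiff_fval c (n := n)).locallyLipschitz (𝕂 := ℝ)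
  exact LocallyLipschitz.max_const h0 0

theorem loclip_vfield {n : ℕ} :
    LocallyLipschitz (fun X : Matrix (Fin n) (Fin n) ℝ => vfield X) :=
  (contDiff_vfield (n := n)).locallyLipschitz (𝕂 := ℝ)

theorem gfield_lip (c R : ℝ) {n : ℕ} :
    LocallyLipschitz (fun X : Matrix (Fin n) (Fin n) ℝ => gfield c R X) :=
  loclip_smul (loclip_cut R) (loclip_fval c) loclip_vfield

theorem gfield_supp (c R : ℝ) {n : ℕ} :
    HasCompactSupport (fun X : Matrix (Fin n) (Fin n) ℝ => gfield c R X) := by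
  apply HasCompactSupport.intro (isCompact_closedBall (0 : Matrix (Fin n) (Fin n) ℝ) (Real.sqrt (R+1)))
  intro X hX
  have : R + 1 - nsq X ≤ 0 := by
    by_contra hcon
    apply hX
    rw [mem_closedBall_zero_iff]
    exact (norm_sq_le_nsq X).trans (Real.sqrt_le_sqrt (by linarith))
  simp [gfield, max_eq_right this]

/-- Let `A₀ ∈ Mₙ(ℝ)` satisfy `f(A₀) > 0`. Then there exists a
differentiable curve `A : [0,∞) → Mₙ(ℝ)` with `A(0) = A₀` solving the reduced Anomaly flow
ODE `A′ = f(A)·(2[[A⁺,A⁻],A] − ‖A⁺‖²A)` for all `t ≥ 0`, with `‖A(t)‖ ≤ ‖A₀‖`; that is,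
the flow is immortal. -/
theorem stmt16 (c : ℝ) (n : ℕ) (A0 : Matrix (Fin n) (Fin n) ℝ) (h0 : 0 < fval c A0) :
    ∃ A : ℝ → Matrix (Fin n) (Fin n) ℝ, A 0 = A0 ∧
      (∀ t ∈ Set.Ici (0 : ℝ), HasDerivWithinAt A (rhs c (A t)) (Set.Ici 0) t) ∧
      ∀ t ∈ Set.Ici (0 : ℝ), Real.sqrt (nsq (A t)) ≤ Real.sqrt (nsq A0) := by
  obtain ⟨A, hA0, hA⟩ := global_sol (fun X : Matrix (Fin n) (Fin n) ℝ => gfield c (nsq A0) X)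
    (gfield_lip c (nsq A0)) (gfield_supp c (nsq A0)) A0
  have hcont : ContinuousOn A (Set.Ici 0) := fun t ht => (hA t ht).continuousWithinAt
  -- monotonicity of the norm
  have hanti : AntitoneOn (fun t => nsq (A t)) (Set.Ici 0) := by
    refine antitoneOn_of_hasDerivWithinAt_nonpos (convex_Ici 0)
      (fun t ht => (hasDeriv_nsq (hA t ht)).continuousWithinAt)
      (f' := fun t => 2 * Matrix.trace (gfield c (nsq A0) (A t) * (A t)ᵀ)) ?_ ?_
    · intro t ht
      exact (hasDeriv_nsq (hA t (interior_subset ht))).mono interior_subset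
    · intro t ht
      rw [gfield, smul_mul_assoc, Matrix.trace_smul, smul_eq_mul]
      have h1 : 0 ≤ min (max (nsq A0 + 1 - nsq (A t)) 0) 1 * max (fval c (A t)) 0 := by positivity
      nlinarith [mul_nonneg h1 (neg_nonneg.2 (trace_vfield (A t)))]
  have hle : ∀ t ∈ Set.Ici (0:ℝ), nsq (A t) ≤ nsq A0 := by
    intro t ht
    have := hanti (Set.mem_Ici.2 le_rfl) ht ht
    simpa [hA0] using this
  -- nonnegativity of f
  have hfc : ContinuousOn (fun t => fval c (A t)) (Set.Ici 0) :=
    (contDiff_fval c).continuous.comp_continuousOn hcont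
  have hf : ∀ t ∈ Set.Ici (0:ℝ), 0 ≤ fval c (A t) := by
    intro t ht
    have ht0 : (0:ℝ) ≤ t := ht
    by_contra hneg
    push Not at hneg
    have hsub : Set.Icc 0 t ⊆ Set.Ici 0 := Set.Icc_subset_Ici_self
    have hcl : IsCompact (Set.Icc 0 t ∩ (fun s => fval c (A s)) ⁻¹' Set.Ici 0) :=
      isCompact_Icc.of_isClosed_subset
        ((hfc.mono hsub).preimage_isClosed_of_isClosed isClosed_Icc isClosed_Ici)
        Set.inter_subset_left
    obtain ⟨s, ⟨hs, hs'⟩, hmax⟩ := hcl.exists_isGreatest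
      ⟨0, ⟨le_rfl, ht0⟩, by simpa [hA0] using h0.le⟩
    have hs2 : 0 ≤ fval c (A s) := hs'
    have hst : A t = A s := by
      refine constant_of_has_deriv_right_zero (f := A) (a := s) (b := t)
        (hcont.mono (Set.Icc_subset_Ici_self.trans (Set.Ici_subset_Ici.2 hs.1))) ?_ t
        ⟨hs.2, le_rfl⟩
      intro u hu
      have hu0 : (0:ℝ) ≤ u := hs.1.trans hu.1
      have hd := (hA u hu0).mono (Set.Ici_subset_Ici.2 hu0)
      have hfu : fval c (A u) ≤ 0 := by
        by_contra hpos
        push Not at hpos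
        have hus : u = s := le_antisymm (hmax ⟨⟨hu0, hu.2.le⟩, hpos.le⟩) hu.1
        -- intermediate value theorem gives a later zero
        have hsub2 : Set.Icc u t ⊆ Set.Ici 0 := fun x hx => hu0.trans hx.1
        obtain ⟨w, hw, hw0⟩ := intermediate_value_Icc' hu.2.le (hfc.mono hsub2)
          (show (0:ℝ) ∈ Set.Icc _ _ from ⟨hneg.le, hpos.le⟩)
        have hw1 : fval c (A w) = 0 := hw0
        have : w ≤ s := hmax ⟨⟨hu0.trans hw.1, hw.2⟩, hw1.ge⟩
        have hwu : w = u := le_antisymm (this.trans hus.ge) hw.1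
        rw [hwu] at hw1
        linarith
      have hz : gfield c (nsq A0) (A u) = 0 := by
        simp [gfield, max_eq_right hfu]
      simpa only [hz] using hd
    rw [hst] at hneg
    linarith
  refine ⟨A, hA0, ?_, fun t ht => Real.sqrt_le_sqrt (hle t ht)⟩
  intro t ht
  have h := hA t ht
  have e : gfield c (nsq A0) (A t) = rhs c (A t) := by
    have h1 : min (max (nsq A0 + 1 - nsq (A t)) 0) 1 = 1 := by
      apply min_eq_right
      exact le_max_of_le_left (by linarith [hle t ht])
    rw [gfield, h1, max_eq_left (hf t ht), one_mul]; rfl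
  rw [← e]; exact h
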